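/- arXiv:1908.08925 — 2 statements merged into one kernel-verified Lean document; each statement's English description precedes it below -/
import Mathlib

section
/- If a real number x is normal in base b, then x is normal in base b^k for every positive integer k. -/
/-- The `k`-th digit (starting from `k = 0`) after the point in the base-`b`
expansion of the fractional part of `x`. -/
noncomputable def digit (b : ℕ) (x : ℝ) (k : ℕ) : ℕ :=
  (⌊Int.fract x * (b : ℝ) ^ (k + 1)⌋ % (b : ℤ)).toNat

/-- `x` is simply normal in base `b`: each digit `d < b` occurs with
asymptotic frequency `1 / b`. -/
def SimplyNormal (b : ℕ) (x : ℝ) : Prop :=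
  ∀ d < b, Filter.Tendsto
    (fun N => (((Finset.range N).filter (fun k => digit b x k = d)).card : ℝ) / N)
    Filter.atTop (nhds (1 / b))

/-- `x` is normal in base `b`: every nonempty finite block of base-`b` digits
of length `n` occurs in the base-`b` expansion of `x` with asymptotic
frequency `b⁻ⁿ`. -/
def IsNormal (b : ℕ) (x : ℝ) : Prop :=
  ∀ n : ℕ, 0 < n → ∀ w : Fin n → Fin b, Filter.Tendsto
    (fun N => (((Finset.range N).filter
        (fun k => ∀ i : Fin n, digit b x (k + i) = w i)).card : ℝ) / N)
    Filter.atTop (nhds (1 / (b : ℝ) ^ n))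

open Filter Topology Finset

lemma abs_sum_range_sub_sum_range_add_le {f : ℕ → ℝ} (hf : ∀ m, |f m| ≤ 1) (t N : ℕ) :
    |∑ j ∈ range N, f j - ∑ j ∈ range N, f (j + t)| ≤ 2 * t := by
  have h₁ := sum_range_add f N t
  have h₂ := sum_range_add f t N
  rw [add_comm t N] at h₂
  have bound (g : ℕ → ℕ) : |∑ j ∈ range t, f (g j)| ≤ t := by
    refine (abs_sum_le_sum_abs _ _).trans ((sum_le_sum fun j _ => hf (g j)).trans ?_)
    simp
  have h₃ := abs_le.1 (bound fun j => j)
  have h₄ := abs_le.1 (bound fun j => N + j)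
  simp only [add_comm _ t]
  rw [abs_le]
  constructor <;> linarith

lemma sum_range_mul_le_sum_range {g : ℕ → ℝ} (hg : ∀ m, 0 ≤ g m) {k : ℕ} (hk : 0 < k) (N : ℕ) :
    ∑ j ∈ range N, g (k * j) ≤ ∑ m ∈ range (k * N), g m := by
  have hinj : Function.Injective fun j : ℕ => k * j := fun a b h => Nat.eq_of_mul_eq_mul_left hk h
  rw [← sum_image (f := g) (g := fun j => k * j) hinj.injOn]
  refine sum_le_sum_of_subset_of_nonneg ?_ fun m _ _ => hg m
  intro m hm
  obtain ⟨j, hj, rfl⟩ := mem_image.1 hm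
  exact mem_range.2 (Nat.mul_lt_mul_of_pos_left (mem_range.1 hj) hk)

/-- If the shifts of a sequence `f` bounded by `1` along multiples of `s` are asymptotically
uncorrelated, the mean square of a sum of `H` such shifts is eventually at most `H + 1`. -/
lemma eventually_sum_sq_le {f : ℕ → ℝ} (hf : ∀ m, |f m| ≤ 1) {s : ℕ}
    (hcorr : ∀ i j, i ≠ j → Tendsto
      (fun N : ℕ => (∑ m ∈ range N, f (m + s * i) * f (m + s * j)) / N) atTop (𝓝 0)) (H : ℕ) :
    ∀ᶠ N : ℕ in atTop,
      ∑ m ∈ range N, (∑ h ∈ range H, f (m + s * h)) ^ 2 ≤ N * (H + 1) := by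
  set c : ℕ → ℕ → ℕ → ℝ := fun i j N => (∑ m ∈ range N, f (m + s * i) * f (m + s * j)) / N
  have hoff : Tendsto (fun N => ∑ i ∈ range H, ∑ j ∈ range H, if i = j then 0 else c i j N)
      atTop (𝓝 0) := by
    have h := tendsto_finsetSum (range H) fun i _ => tendsto_finsetSum (range H) fun j _ =>
      show Tendsto (fun N => if i = j then 0 else c i j N) atTop (𝓝 0) by
        by_cases hij : i = j
        · simp [hij]
        · simpa [hij] using hcorr i j hij
    simpa using h
  filter_upwards [hoff.eventually (gt_mem_nhds one_pos), eventually_gt_atTop 0] with N hN hpos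
  have hN0 : (0 : ℝ) < N := by exact_mod_cast hpos
  have hdiag (i : ℕ) : c i i N ≤ 1 := by
    refine (div_le_one hN0).2 ?_
    calc ∑ m ∈ range N, f (m + s * i) * f (m + s * i) ≤ ∑ m ∈ range N, (1 : ℝ) :=
          sum_le_sum fun m _ => by
            have := abs_le.1 (hf (m + s * i))
            nlinarith
      _ = N := by simp
  have hexp : ∑ m ∈ range N, (∑ h ∈ range H, f (m + s * h)) ^ 2
      = N * ∑ i ∈ range H, ∑ j ∈ range H, c i j N := by
    simp only [sq (∑ h ∈ range H, _), sum_mul_sum]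
    rw [sum_comm, mul_sum]
    refine sum_congr rfl fun i _ => ?_
    rw [sum_comm, mul_sum]
    exact sum_congr rfl fun j _ => (mul_div_cancel₀ _ hN0.ne').symm
  rw [hexp]
  refine mul_le_mul_of_nonneg_left ?_ hN0.le
  calc ∑ i ∈ range H, ∑ j ∈ range H, c i j N
      ≤ ∑ i ∈ range H, ∑ j ∈ range H, ((if i = j then 1 else 0) + if i = j then 0 else c i j N) :=
        sum_le_sum fun i _ => sum_le_sum fun j _ => by
          by_cases hij : i = j
          · subst hij
            simpa using hdiag i
          · simp [hij]
    _ = H + ∑ i ∈ range H, ∑ j ∈ range H, (if i = j then 0 else c i j N) := by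
        simp only [sum_add_distrib]
        congr 1
        rw [sum_congr rfl fun i hi => by rw [sum_ite_eq, if_pos hi]]
        simp
    _ ≤ H + 1 := by linarith

/-- A van der Corput type estimate: asymptotic uncorrelatedness of the shifts of `f` along
multiples of `k * L` forces the means of `f` along multiples of `k` to vanish. -/
lemma tendsto_mean_mul_of_correlations {f : ℕ → ℝ} (hf : ∀ m, |f m| ≤ 1) {k L : ℕ} (hk : 0 < k)
    (hcorr : ∀ i j, i ≠ j → Tendsto
      (fun N : ℕ => (∑ m ∈ range N, f (m + k * L * i) * f (m + k * L * j)) / N) atTop (𝓝 0)) :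
    Tendsto (fun N : ℕ => (∑ j ∈ range N, f (k * j)) / N) atTop (𝓝 0) := by
  rw [Metric.tendsto_atTop']
  intro ε hε
  have hk' : (0 : ℝ) < k := by exact_mod_cast hk
  obtain ⟨H, hH⟩ := exists_nat_gt (max 1 (2 * k / (ε / 2) ^ 2))
  have hH1 : (1 : ℝ) < H := (le_max_left _ _).trans_lt hH
  have hH0 : (0 : ℝ) < H := by linarith
  have hHε : 2 * k < H * (ε / 2) ^ 2 :=
    (div_lt_iff₀ (by positivity)).1 ((le_max_right _ _).trans_lt hH)
  have hsq := (tendsto_id.const_mul_atTop' hk).eventually (eventually_sum_sq_le hf hcorr H)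
  have hlarge := tendsto_natCast_atTop_atTop (R := ℝ) |>.eventually_gt_atTop (2 * L * H / (ε / 2))
  obtain ⟨M, hM⟩ := eventually_atTop.1 ((hsq.and hlarge).and (eventually_gt_atTop 0))
  refine ⟨M, fun N hN => ?_⟩
  obtain ⟨⟨h₁, h₂⟩, h₃⟩ := hM N hN.le
  have hN0 : (0 : ℝ) < N := by exact_mod_cast h₃
  rw [div_lt_iff₀ (by positivity)] at h₂
  set G : ℕ → ℝ := fun m => ∑ h ∈ range H, f (m + k * L * h) with hG
  have hshift : |H * ∑ j ∈ range N, f (k * j) - ∑ j ∈ range N, G (k * j)| ≤ H * (2 * L * H) := by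
    have heq : H * ∑ j ∈ range N, f (k * j) - ∑ j ∈ range N, G (k * j)
        = ∑ h ∈ range H, (∑ j ∈ range N, f (k * j) - ∑ j ∈ range N, f (k * (j + L * h))) := by
      rw [sum_sub_distrib, sum_const, card_range, nsmul_eq_mul, hG, sum_comm]
      simp only [mul_add, mul_assoc]
    rw [heq]
    refine (abs_sum_le_sum_abs _ _).trans ?_
    calc ∑ h ∈ range H, |∑ j ∈ range N, f (k * j) - ∑ j ∈ range N, f (k * (j + L * h))|
        ≤ ∑ h ∈ range H, (2 * L * H : ℝ) := sum_le_sum fun h hh => by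
          have hle : (h : ℝ) ≤ H := by exact_mod_cast (mem_range.1 hh).le
          refine (abs_sum_range_sub_sum_range_add_le (f := fun j => f (k * j))
            (fun j => hf _) (L * h) N).trans ?_
          push_cast
          rw [← mul_assoc]
          gcongr
      _ = H * (2 * L * H) := by simp
  have hGsq : (∑ j ∈ range N, G (k * j)) ^ 2 < (N * H * (ε / 2)) ^ 2 := by
    calc (∑ j ∈ range N, G (k * j)) ^ 2 ≤ N * ∑ j ∈ range N, G (k * j) ^ 2 := by
          simpa using sq_sum_le_card_mul_sum_sq (s := range N) (f := fun j => G (k * j))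
      _ ≤ N * ∑ m ∈ range (k * N), G m ^ 2 := by
          gcongr
          exact sum_range_mul_le_sum_range (fun m => sq_nonneg (G m)) hk N
      _ ≤ N * ((k * N : ℕ) * (H + 1)) := by
          gcongr
          exact h₁
      _ ≤ N ^ 2 * (H * (2 * k)) := by
          push_cast
          have : (N : ℝ) ^ 2 * k * (H + 1) ≤ N ^ 2 * k * (2 * H) := by
            gcongr
            linarith
          linarith
      _ < N ^ 2 * (H * (H * (ε / 2) ^ 2)) := by gcongr
      _ = (N * H * (ε / 2)) ^ 2 := by ring
  have hGabs : |∑ j ∈ range N, G (k * j)| < N * H * (ε / 2) :=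
    abs_lt_of_sq_lt_sq hGsq (by positivity)
  have hfin : H * |∑ j ∈ range N, f (k * j)| < H * (ε * N) := by
    calc H * |∑ j ∈ range N, f (k * j)| = |H * ∑ j ∈ range N, f (k * j)| := by
          rw [abs_mul, Nat.abs_cast]
      _ ≤ |H * ∑ j ∈ range N, f (k * j) - ∑ j ∈ range N, G (k * j)|
          + |∑ j ∈ range N, G (k * j)| := by
          simpa using abs_add_le (H * ∑ j ∈ range N, f (k * j) - ∑ j ∈ range N, G (k * j))
            (∑ j ∈ range N, G (k * j))
      _ < H * (N * (ε / 2)) + N * H * (ε / 2) :=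
          add_lt_add (hshift.trans_lt (by gcongr)) hGabs
      _ = H * (ε * N) := by ring
  rw [Real.dist_eq, sub_zero, abs_div, Nat.abs_cast, div_lt_iff₀ hN0]
  exact lt_of_mul_lt_mul_left hfin hH0.le

lemma digit_lt {b : ℕ} (hb : 0 < b) (x : ℝ) (m : ℕ) : digit b x m < b := by
  unfold digit
  have := Int.emod_lt_of_pos ⌊Int.fract x * (b : ℝ) ^ (m + 1)⌋ (by exact_mod_cast hb : (0 : ℤ) < b)
  omega

lemma digit_eq_natFloor_mod (b : ℕ) (x : ℝ) (m : ℕ) :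
    digit b x m = ⌊Int.fract x * (b : ℝ) ^ (m + 1)⌋₊ % b := by
  have h : 0 ≤ Int.fract x * (b : ℝ) ^ (m + 1) := by
    have := Int.fract_nonneg x
    positivity
  rw [digit, ← Int.natCast_floor_eq_floor h]
  norm_cast

lemma natFloor_mul_pow_div {b : ℕ} (hb : 0 < b) (y : ℝ) (m r : ℕ) :
    ⌊y * (b : ℝ) ^ (m + r)⌋₊ / b ^ r = ⌊y * (b : ℝ) ^ m⌋₊ := by
  have hb' : (b : ℝ) ≠ 0 := by exact_mod_cast hb.ne'
  rw [← Nat.floor_div_natCast]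
  congr 1
  push_cast
  rw [pow_add]
  field_simp

lemma mod_pow_eq_iff_digits {b : ℕ} (u v k : ℕ) :
    u % b ^ k = v % b ^ k ↔ ∀ e < k, u / b ^ e % b = v / b ^ e % b := by
  constructor
  · intro h e he
    rw [← Nat.mod_mul_right_div_self u, ← Nat.mod_mul_right_div_self v, ← pow_succ,
      ← Nat.mod_mod_of_dvd u (pow_dvd_pow b he), h, Nat.mod_mod_of_dvd v (pow_dvd_pow b he)]
  · intro h
    induction k with
    | zero => simp [Nat.mod_one]
    | succ k ih =>
      rw [Nat.mod_pow_succ, Nat.mod_pow_succ, ih fun e he => h e (by omega), h k (by omega)]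

/-- A digit in base `b ^ k` is determined by the corresponding block of `k` digits in base `b`. -/
lemma digit_pow_eq_iff {b k : ℕ} (hb : 0 < b) (x : ℝ) (j : ℕ) {v : ℕ} (hv : v < b ^ k) :
    digit (b ^ k) x j = v ↔ ∀ r < k, digit b x (k * j + r) = v / b ^ (k - 1 - r) % b := by
  have hdig (r : ℕ) (hr : r < k) : digit b x (k * j + r)
      = ⌊Int.fract x * (b : ℝ) ^ (k * (j + 1))⌋₊ / b ^ (k - 1 - r) % b := by
    rw [digit_eq_natFloor_mod, ← natFloor_mul_pow_div hb _ _ (k - 1 - r)]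
    congr 5
    rw [mul_add]
    omega
  rw [digit_eq_natFloor_mod, Nat.cast_pow, ← pow_mul]
  conv_lhs => rw [← Nat.mod_eq_of_lt hv]
  rw [mod_pow_eq_iff_digits]
  constructor
  · intro h r hr
    rw [hdig r hr, h _ (by omega)]
  · intro h e he
    have := h (k - 1 - e) (by omega)
    rwa [hdig _ (by omega), show k - 1 - (k - 1 - e) = e by omega] at this

lemma forall_digit_pow_eq_iff {b k n : ℕ} (hb : 0 < b) (hk : 0 < k) (x : ℝ)
    (w : Fin n → Fin (b ^ k)) {W : ℕ → ℕ}
    (hW : ∀ (i : Fin n), ∀ r < k, W (k * i + r) = (w i : ℕ) / b ^ (k - 1 - r) % b) (j : ℕ) :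
    (∀ i : Fin n, digit (b ^ k) x (j + i) = w i) ↔
      ∀ q ∈ range (k * n), digit b x (k * j + q) = W q := by
  simp only [digit_pow_eq_iff hb x _ (w _).isLt, mem_range]
  constructor
  · intro h q hq
    have := h ⟨q / k, Nat.div_lt_of_lt_mul hq⟩ (q % k) (Nat.mod_lt q hk)
    rw [← hW _ _ (Nat.mod_lt q hk), mul_add, add_assoc, Nat.div_add_mod] at this
    exact this
  · intro h i r hr
    rw [mul_add, add_assoc, h _ (by nlinarith [i.isLt]), hW i r hr]

/-- In a normal expansion, digits prescribed at finitely many positions, not necessarily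
consecutive, occur with the expected frequency. -/
lemma IsNormal.tendsto_card_filter_div {b : ℕ} (hb : 0 < b) {x : ℝ} (hx : IsNormal b x)
    (I : Finset ℕ) (w : ℕ → ℕ) (hw : ∀ i ∈ I, w i < b) :
    Tendsto (fun N => (((range N).filter fun m => ∀ i ∈ I, digit b x (m + i) = w i).card : ℝ) / N)
      atTop (𝓝 (1 / (b : ℝ) ^ I.card)) := by
  have hb' : (b : ℝ) ≠ 0 := by exact_mod_cast hb.ne'
  obtain ⟨n, hn⟩ : ∃ n, I ⊆ range (n + 1) :=
    ⟨I.sup id, fun i hi => mem_range.2 (Nat.lt_succ_of_le (le_sup (f := id) hi))⟩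
  induction hd : n + 1 - I.card generalizing I w with
  | zero =>
    have hI : I = range (n + 1) := eq_of_subset_of_card_le hn (by simp; omega)
    subst hI
    have h := hx (n + 1) n.succ_pos fun i => ⟨w i, hw i (mem_range.2 i.isLt)⟩
    simpa [Fin.forall_iff] using h
  | succ d ih =>
    obtain ⟨i, hi, hiI⟩ : ∃ i ∈ range (n + 1), i ∉ I := by
      by_contra! hcon
      have := card_le_card (show range (n + 1) ⊆ I from hcon)
      rw [card_range] at this
      omega
    have hlim := tendsto_finsetSum (range b) fun c hc =>
      ih (insert i I) (Function.update w i c) (fun a ha => by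
          rcases eq_or_ne a i with rfl | hne
          · simpa using hc
          · simpa [hne] using hw a ((mem_insert.1 ha).resolve_left hne))
        (insert_subset hi hn) (by rw [card_insert_of_notMem hiI]; omega)
    have hval : ∑ _c ∈ range b, 1 / (b : ℝ) ^ (insert i I).card = 1 / (b : ℝ) ^ I.card := by
      rw [sum_const, card_range, nsmul_eq_mul, card_insert_of_notMem hiI, pow_succ]
      field_simp
    rw [hval] at hlim
    refine hlim.congr fun N => ?_
    rw [← sum_div, ← Nat.cast_sum]
    congr 2
    rw [card_eq_sum_card_fiberwise (f := fun m => digit b x (m + i)) (t := range b)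
      fun m _ => by simpa using digit_lt hb x (m + i)]
    refine sum_congr rfl fun c _ => ?_
    congr 1
    rw [filter_filter]
    refine filter_congr fun m _ => ?_
    rw [forall_mem_insert, Function.update_self, and_comm]
    refine and_congr_left fun _ => forall₂_congr fun a ha => ?_
    rw [Function.update_of_ne (ne_of_mem_of_not_mem ha hiI)]

/-- In a normal expansion, occurrences of a block of length `L` at two shifts at distance at
least `L` are asymptotically uncorrelated. -/
lemma IsNormal.tendsto_correlation {b : ℕ} (hb : 0 < b) {x : ℝ} (hx : IsNormal b x) {L : ℕ}
    {W : ℕ → ℕ} (hW : ∀ q < L, W q < b) {f : ℕ → ℝ}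
    (hf : ∀ m, f m = (if ∀ q ∈ range L, digit b x (m + q) = W q then 1 else 0) - 1 / (b : ℝ) ^ L)
    {s t : ℕ} (hst : s + L ≤ t) :
    Tendsto (fun N : ℕ => (∑ m ∈ range N, f (m + s) * f (m + t)) / N) atTop (𝓝 0) := by
  set p : ℝ := 1 / (b : ℝ) ^ L with hp
  have hshift (s m : ℕ) : (∀ q ∈ range L, digit b x (m + s + q) = W q) ↔
      ∀ i ∈ Ico s (s + L), digit b x (m + i) = W (i - s) := by
    simp only [mem_range, mem_Ico]
    constructor
    · rintro h i ⟨h₁, h₂⟩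
      have := h (i - s) (by omega)
      rwa [show m + s + (i - s) = m + i by omega] at this
    · intro h q hq
      have := h (s + q) ⟨by omega, by omega⟩
      rwa [← add_assoc, Nat.add_sub_cancel_left] at this
  have hone (s : ℕ) := hx.tendsto_card_filter_div hb (Ico s (s + L)) (fun i => W (i - s))
    fun i hi => hW _ (by have := mem_Ico.1 hi; omega)
  have hdisj : Disjoint (Ico s (s + L)) (Ico t (t + L)) := by
    rw [disjoint_left]
    intro i h₁ h₂
    simp only [mem_Ico] at h₁ h₂
    omega
  have htwo := hx.tendsto_card_filter_div hb (Ico s (s + L) ∪ Ico t (t + L))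
    (fun i => if i < t then W (i - s) else W (i - t)) fun i hi => by
      simp only [mem_union, mem_Ico] at hi
      split_ifs <;> exact hW _ (by omega)
  have hboth (m : ℕ) : (∀ i ∈ Ico s (s + L) ∪ Ico t (t + L),
        digit b x (m + i) = if i < t then W (i - s) else W (i - t)) ↔
      (∀ i ∈ Ico s (s + L), digit b x (m + i) = W (i - s)) ∧
        ∀ i ∈ Ico t (t + L), digit b x (m + i) = W (i - t) := by
    rw [forall_mem_union]
    refine and_congr (forall₂_congr fun i hi => ?_) (forall₂_congr fun i hi => ?_) <;>
      rw [mem_Ico] at hi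
    · rw [if_pos (by omega)]
    · rw [if_neg (by omega)]
  have hs := hone s
  have ht := hone t
  simp only [Nat.card_Ico, Nat.add_sub_cancel_left, ← hp] at hs ht
  rw [card_union_of_disjoint hdisj, Nat.card_Ico, Nat.card_Ico, Nat.add_sub_cancel_left,
    Nat.add_sub_cancel_left, pow_add, ← one_div_mul_one_div, ← hp] at htwo
  have hlim := ((htwo.sub (hs.const_mul p)).sub (ht.const_mul p)).add_const (p * p)
  rw [show p * p - p * p - p * p + p * p = 0 by ring] at hlim
  refine hlim.congr' ?_
  filter_upwards [eventually_gt_atTop 0] with N hN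
  have hN0 : (N : ℝ) ≠ 0 := by exact_mod_cast hN.ne'
  simp only [hf, hshift, hboth, card_filter, Nat.cast_sum, Nat.cast_ite, Nat.cast_one,
    Nat.cast_zero]
  field_simp
  rw [mul_sum, mul_sum, ← sum_sub_distrib, ← sum_sub_distrib,
    show (N : ℝ) * p ^ 2 = ∑ _m ∈ range N, p ^ 2 by simp, ← sum_add_distrib]
  refine sum_congr rfl fun m _ => ?_
  rw [ite_and]
  split_ifs <;> ring

theorem normal_pow {b : ℕ} (hb : 2 ≤ b) {x : ℝ} (hx : IsNormal b x) :
    ∀ k : ℕ, 0 < k → IsNormal (b ^ k) x := by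
  intro k hk n hn w
  have hb0 : 0 < b := by omega
  set W : ℕ → ℕ := fun q =>
    if h : q / k < n then (w ⟨q / k, h⟩ : ℕ) / b ^ (k - 1 - q % k) % b else 0
  have hW (i : Fin n) (r : ℕ) (hr : r < k) :
      W (k * i + r) = (w i : ℕ) / b ^ (k - 1 - r) % b := by
    have h₁ : (k * i + r) / k = i := by
      rw [Nat.mul_add_div hk, Nat.div_eq_of_lt hr, add_zero]
    have h₂ : (k * i + r) % k = r := by
      rw [Nat.mul_add_mod, Nat.mod_eq_of_lt hr]
    simp [W, h₁, h₂]
  have hWb (q : ℕ) (_ : q < k * n) : W q < b := by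
    dsimp only [W]
    split_ifs
    · exact Nat.mod_lt _ hb0
    · exact hb0
  set p : ℝ := 1 / (b : ℝ) ^ (k * n) with hp
  have hp0 : 0 ≤ p := by positivity
  have hp1 : p ≤ 1 := by
    rw [hp, div_le_one (by positivity)]
    exact one_le_pow₀ (by exact_mod_cast hb0)
  set f : ℕ → ℝ := fun m =>
    (if ∀ q ∈ range (k * n), digit b x (m + q) = W q then 1 else 0) - p with hf
  have hf1 (m : ℕ) : |f m| ≤ 1 := by
    rw [abs_le]
    dsimp only [f]
    split_ifs <;> constructor <;> linarith
  have hsep {i j : ℕ} (hij : i < j) : k * (k * n) * i + k * n ≤ k * (k * n) * j := by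
    have h₁ : k * (k * n) * (i + 1) ≤ k * (k * n) * j := Nat.mul_le_mul_left _ hij
    have h₂ : k * n ≤ k * (k * n) := Nat.le_mul_of_pos_left _ hk
    linarith
  have hmean := tendsto_mean_mul_of_correlations (L := k * n) hf1 hk fun i j hij => by
    rcases lt_or_gt_of_ne hij with h | h
    · exact hx.tendsto_correlation hb0 hWb (fun m => rfl) (hsep h)
    · simpa only [mul_comm] using hx.tendsto_correlation hb0 hWb (fun m => rfl) (hsep h)
  have hlim := hmean.add_const p
  rw [zero_add] at hlim
  rw [Nat.cast_pow, ← pow_mul, ← hp]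
  refine hlim.congr' ?_
  filter_upwards [eventually_gt_atTop 0] with N hN
  have hN0 : (N : ℝ) ≠ 0 := by exact_mod_cast hN.ne'
  simp only [forall_digit_pow_eq_iff hb0 hk x w hW, hf, sum_sub_distrib, sum_const, card_range,
    nsmul_eq_mul, sum_boole]
  field_simp
  ring
end

section
/- Almost every real number (with respect to Lebesgue measure) is normal in base b, for every fixed integer b ≥ 2. -/
open MeasureTheory ProbabilityTheory Filter Set
open scoped Topology ENNReal

/-- The uniform measure on the unit interval `[0, 1)`. -/
noncomputable def unitMeasure : Measure ℝ := volume.restrict (Ico 0 1)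

instance isProbabilityMeasure_unitMeasure : IsProbabilityMeasure unitMeasure :=
  ⟨by simp [unitMeasure]⟩

/-- The integer part of `B` times the fractional part of `x`. -/
noncomputable def leadingPart (B : ℕ) (x : ℝ) : ℤ := ⌊Int.fract x * B⌋

/-- The map `x ↦ B x mod 1`, evaluated at the fractional part of `x`. -/
noncomputable def mulModOne (B : ℕ) (x : ℝ) : ℝ := Int.fract (Int.fract x * B)

lemma measurable_leadingPart (B : ℕ) : Measurable (leadingPart B) := by
  unfold leadingPart; fun_prop

lemma measurable_mulModOne (B : ℕ) : Measurable (mulModOne B) := by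
  unfold mulModOne; fun_prop

lemma leadingPart_mem_Ico {B : ℕ} (hB : 0 < B) (x : ℝ) :
    leadingPart B x ∈ Finset.Ico (0 : ℤ) B := by
  have hB' : (0 : ℝ) < B := by exact_mod_cast hB
  rw [Finset.mem_Ico, leadingPart]
  refine ⟨Int.floor_nonneg.2 (mul_nonneg (Int.fract_nonneg x) hB'.le), Int.floor_lt.2 ?_⟩
  simpa using mul_lt_of_lt_one_left hB' (Int.fract_lt_one x)

lemma measure_leadingPart_eq_inter {B : ℕ} (hB : 0 < B) {m : ℤ}
    (hm : m ∈ Finset.Ico (0 : ℤ) B) (A : Set ℝ) :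
    unitMeasure (leadingPart B ⁻¹' {m} ∩ mulModOne B ⁻¹' A) =
      (B : ℝ≥0∞)⁻¹ * unitMeasure A := by
  have hB' : (0 : ℝ) < B := by exact_mod_cast hB
  rw [Finset.mem_Ico] at hm
  have hm0 : (0 : ℝ) ≤ m := by exact_mod_cast hm.1
  have hm1 : (m : ℝ) + 1 ≤ B := by exact_mod_cast hm.2
  have key : leadingPart B ⁻¹' {m} ∩ mulModOne B ⁻¹' A ∩ Ico 0 1 =
      (fun x : ℝ => x * B) ⁻¹' ((fun y => y - m) ⁻¹' (A ∩ Ico 0 1)) := by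
    ext x
    simp only [mem_inter_iff, mem_preimage, mem_singleton_iff, leadingPart, mulModOne]
    constructor
    · rintro ⟨⟨h1, h2⟩, hx⟩
      rw [Int.fract_eq_self.2 hx] at h1 h2
      have h3 : Int.fract (x * B) = x * B - m := by rw [← h1, Int.self_sub_floor]
      rw [← h3]
      exact ⟨h2, Int.fract_nonneg _, Int.fract_lt_one _⟩
    · rintro ⟨h1, h2, h3⟩
      have hx : x ∈ Ico (0 : ℝ) 1 := by
        constructor
        · by_contra! h
          nlinarith
        · by_contra! h
          nlinarith
      have h4 : ⌊x * B⌋ = m := Int.floor_eq_iff.2 ⟨by linarith, by linarith⟩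
      rw [Int.fract_eq_self.2 hx]
      refine ⟨⟨h4, ?_⟩, hx⟩
      rwa [← Int.self_sub_floor, h4]
  rw [unitMeasure, Measure.restrict_apply' measurableSet_Ico,
    Measure.restrict_apply' measurableSet_Ico, key, Real.volume_preimage_mul_right hB'.ne',
    (measurePreserving_sub_right volume (m : ℝ)).measure_preimage_emb
      (MeasurableEquiv.subRight (m : ℝ)).measurableEmbedding,
    abs_of_pos (inv_pos.2 hB'), ENNReal.ofReal_inv_of_pos hB', ENNReal.ofReal_natCast]

lemma measure_leadingPart_mem_inter {B : ℕ} (hB : 0 < B) (S : Set ℤ) {A : Set ℝ}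
    (hA : MeasurableSet A) :
    unitMeasure (leadingPart B ⁻¹' S ∩ mulModOne B ⁻¹' A) =
      ∑ m ∈ Finset.Ico (0 : ℤ) B, S.indicator (fun _ => (B : ℝ≥0∞)⁻¹) m * unitMeasure A := by
  classical
  have hT := measurable_mulModOne B hA
  have hS : leadingPart B ⁻¹' S =
      leadingPart B ⁻¹' ((Finset.Ico (0 : ℤ) B).filter (· ∈ S) : Finset ℤ) := by
    ext x
    have := leadingPart_mem_Ico hB x
    simp only [mem_preimage, Finset.coe_filter, mem_ofPred_eq, this, true_and]
  rw [← Measure.restrict_apply' hT, hS, ← sum_measure_preimage_singleton _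
    fun y _ => measurable_leadingPart B (measurableSet_singleton y), Finset.sum_filter]
  refine Finset.sum_congr rfl fun m hm => ?_
  by_cases h : m ∈ S
  · simp [h, Measure.restrict_apply' hT, measure_leadingPart_eq_inter hB hm]
  · simp [h]

lemma measurePreserving_mulModOne {B : ℕ} (hB : 0 < B) :
    MeasurePreserving (mulModOne B) unitMeasure unitMeasure := by
  refine ⟨measurable_mulModOne B, Measure.ext fun A hA => ?_⟩
  have h := measure_leadingPart_mem_inter hB univ hA
  rw [preimage_univ, univ_inter] at h
  rw [Measure.map_apply (measurable_mulModOne B) hA, h]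
  have hB' : (B : ℝ≥0∞) ≠ 0 := by exact_mod_cast hB.ne'
  simp [← mul_assoc, ENNReal.mul_inv_cancel hB' (ENNReal.natCast_ne_top B)]

lemma indepFun_leadingPart_mulModOne {B : ℕ} (hB : 0 < B) :
    IndepFun (leadingPart B) (mulModOne B) unitMeasure := by
  rw [indepFun_iff_measure_inter_preimage_eq_mul]
  intro S A _ hA
  have h := measure_leadingPart_mem_inter hB S MeasurableSet.univ
  rw [preimage_univ, inter_univ] at h
  rw [(measurePreserving_mulModOne hB).measure_preimage hA.nullMeasurableSet, h,
    measure_leadingPart_mem_inter hB S hA, Finset.sum_mul]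
  simp

lemma digit_fract (b : ℕ) (x : ℝ) (k : ℕ) : digit b (Int.fract x) k = digit b x k := by
  simp only [digit, Int.fract_fract]

lemma measurable_digit (b k : ℕ) : Measurable fun x => digit b x k := by
  unfold digit
  exact (Measurable.of_discrete (f := fun z : ℤ => (z % (b : ℤ)).toNat)).comp (by fun_prop)

lemma digit_mulModOne_pow (b : ℕ) (x : ℝ) (m k : ℕ) :
    digit b (mulModOne (b ^ m) x) k = digit b x (m + k) := by
  have h : Int.fract x * (b : ℝ) ^ (m + k + 1) =
      Int.fract (Int.fract x * (b : ℝ) ^ m) * (b : ℝ) ^ (k + 1) +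
        ((⌊Int.fract x * (b : ℝ) ^ m⌋ * (b : ℤ) ^ (k + 1) : ℤ) : ℝ) := by
    push_cast
    rw [← add_mul, Int.fract_add_floor]
    ring
  simp only [digit, mulModOne, Int.fract_fract, Nat.cast_pow]
  rw [h, Int.floor_add_intCast, pow_succ (b : ℤ), ← mul_assoc, Int.add_mul_emod_self_right]

lemma digit_eq_leadingPart {b : ℕ} (hb : 0 < b) (x : ℝ) {k L : ℕ} (hk : k < L) :
    digit b x k = (leadingPart (b ^ L) x / (b ^ (L - (k + 1)) : ℕ) % (b : ℤ)).toNat := by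
  have hb' : (b : ℝ) ≠ 0 := by exact_mod_cast hb.ne'
  have h : Int.fract x * (b : ℝ) ^ (k + 1) =
      Int.fract x * ((b ^ L : ℕ) : ℝ) / ((b ^ (L - (k + 1)) : ℕ) : ℝ) := by
    push_cast
    rw [eq_div_iff (pow_ne_zero _ hb'), mul_assoc, ← pow_add, Nat.add_sub_of_le hk]
  rw [leadingPart, digit, ← Int.floor_div_natCast, h]

/-- The indicator of the event that the digits of `x` from position `k` on start with `w`. -/
noncomputable def blockIndicator {b n : ℕ} (w : Fin n → Fin b) (k : ℕ) (x : ℝ) : ℝ :=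
  if ∀ i : Fin n, digit b x (k + i) = w i then 1 else 0

lemma measurableSet_block {b n : ℕ} (w : Fin n → Fin b) (k : ℕ) :
    MeasurableSet {x | ∀ i : Fin n, digit b x (k + i) = w i} := by
  rw [ofPred_forall]
  exact MeasurableSet.iInter fun i => measurable_digit b _ (measurableSet_singleton _)

lemma measurable_blockIndicator {b n : ℕ} (w : Fin n → Fin b) (k : ℕ) :
    Measurable (blockIndicator w k) :=
  Measurable.ite (measurableSet_block w k) measurable_const measurable_const

lemma blockIndicator_add {b n : ℕ} (w : Fin n → Fin b) (m k : ℕ) :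
    blockIndicator w (m + k) = blockIndicator w k ∘ mulModOne (b ^ m) := by
  ext x
  simp [blockIndicator, digit_mulModOne_pow, add_assoc]

lemma indepFun_blockIndicator {b n : ℕ} (hb : 0 < b) (w : Fin n → Fin b) {k l : ℕ}
    (hkl : k + n ≤ l) :
    IndepFun (blockIndicator w k) (blockIndicator w l) unitMeasure := by
  obtain ⟨j, rfl⟩ := Nat.exists_eq_add_of_le hkl
  rw [blockIndicator_add w (k + n) j]
  have h : blockIndicator w k = (fun z : ℤ => if ∀ i : Fin n,
      (z / (b ^ (k + n - (k + i + 1)) : ℕ) % (b : ℤ)).toNat = w i then (1 : ℝ) else 0) ∘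
        leadingPart (b ^ (k + n)) := by
    ext x
    simp only [blockIndicator, Function.comp_apply]
    congr 1
    refine propext (forall_congr' fun i => ?_)
    rw [digit_eq_leadingPart hb x (Nat.add_lt_add_left i.isLt k)]
  rw [h]
  exact (indepFun_leadingPart_mulModOne (pow_pos hb _)).comp Measurable.of_discrete
    (measurable_blockIndicator w j)

lemma identDistrib_blockIndicator {b n : ℕ} (hb : 0 < b) (w : Fin n → Fin b) (k : ℕ) :
    IdentDistrib (blockIndicator w k) (blockIndicator w 0) unitMeasure unitMeasure where
  aemeasurable_fst := (measurable_blockIndicator w k).aemeasurable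
  aemeasurable_snd := (measurable_blockIndicator w 0).aemeasurable
  map_eq := by
    have hT := measurePreserving_mulModOne (pow_pos hb k)
    have h : blockIndicator w k = blockIndicator w 0 ∘ mulModOne (b ^ k) :=
      blockIndicator_add w k 0
    rw [h,
      ← Measure.map_map (measurable_blockIndicator w 0) hT.measurable, hT.map_eq]

lemma measure_block {b : ℕ} (hb : 0 < b) {n : ℕ} (w : Fin n → Fin b) :
    unitMeasure {x | ∀ i : Fin n, digit b x i = w i} = ((b : ℝ≥0∞) ^ n)⁻¹ := by
  induction n with
  | zero => simp
  | succ n ih =>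
    have h : {x | ∀ i : Fin (n + 1), digit b x i = w i} =
        leadingPart b ⁻¹' {((w 0 : ℕ) : ℤ)} ∩
          mulModOne b ⁻¹' {x | ∀ i : Fin n, digit b x i = w i.succ} := by
      ext x
      have h0 : digit b x 0 = w 0 ↔ leadingPart b x = (w 0 : ℕ) := by
        have hx := Finset.mem_Ico.1 (leadingPart_mem_Ico hb x)
        have : digit b x 0 = (leadingPart b x).toNat := by
          simp only [digit, zero_add, pow_one]
          rw [← leadingPart, Int.emod_eq_of_lt hx.1 hx.2]
        omega
      have h1 (i : ℕ) : digit b (mulModOne b x) i = digit b x (i + 1) := by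
        simpa [add_comm] using digit_mulModOne_pow b x 1 i
      simp [Fin.forall_fin_succ, h0, h1]
    rw [h, measure_leadingPart_eq_inter hb (by simp), ih, pow_succ', ENNReal.mul_inv]
    · simp
    · simp

lemma integral_blockIndicator {b n : ℕ} (hb : 0 < b) (w : Fin n → Fin b) (k : ℕ) :
    ∫ x, blockIndicator w k x ∂unitMeasure = 1 / (b : ℝ) ^ n := by
  rw [(identDistrib_blockIndicator hb w k).integral_eq]
  have h : blockIndicator w 0 = {x | ∀ i : Fin n, digit b x i = w i}.indicator 1 := by
    ext x
    simp [blockIndicator, indicator_apply]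
  have hm : MeasurableSet {x | ∀ i : Fin n, digit b x i = w i} := by
    simpa using measurableSet_block w 0
  rw [h, integral_indicator_one hm, measureReal_def, measure_block hb]
  simp

lemma integrable_blockIndicator {b n : ℕ} (w : Fin n → Fin b) (k : ℕ) :
    Integrable (blockIndicator w k) unitMeasure := by
  refine Integrable.of_bound (measurable_blockIndicator w k).aestronglyMeasurable 1
    (Eventually.of_forall fun x => ?_)
  unfold blockIndicator
  split_ifs <;> simp

/-- Averages of a bounded sequence converge if they converge along each residue class. -/
lemma tendsto_average_of_residues {f : ℕ → ℝ} {n : ℕ} (hn : 0 < n) {C p : ℝ}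
    (hf : ∀ k, |f k| ≤ C)
    (h : ∀ r < n, Tendsto (fun M : ℕ => (∑ j ∈ Finset.range M, f (r + n * j)) / M)
      atTop (𝓝 p)) :
    Tendsto (fun N : ℕ => (∑ k ∈ Finset.range N, f k) / N) atTop (𝓝 p) := by
  have hn' : (n : ℝ) ≠ 0 := by exact_mod_cast hn.ne'
  have hsum (M : ℕ) : ∑ k ∈ Finset.range (n * M), f k =
      ∑ r ∈ Finset.range n, ∑ j ∈ Finset.range M, f (r + n * j) := by
    induction M with
    | zero => simp
    | succ M ih =>
      rw [Nat.mul_succ, Finset.sum_range_add, ih, ← Finset.sum_add_distrib]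
      simp [Finset.sum_range_succ, add_comm]
  have hmul : Tendsto (fun M : ℕ => (∑ k ∈ Finset.range (n * M), f k) / M) atTop
      (𝓝 (n * p)) := by
    simp_rw [hsum, Finset.sum_div (Finset.range n)]
    simpa only [Finset.sum_const, Finset.card_range, nsmul_eq_mul] using
      tendsto_finsetSum (Finset.range n) fun r hr => h r (Finset.mem_range.1 hr)
  have hquot : Tendsto (fun N : ℕ => ((N / n : ℕ) : ℝ) / N) atTop (𝓝 (n : ℝ)⁻¹) := by
    have := (tendsto_nat_floor_mul_div_atTop (R := ℝ) (a := (n : ℝ)⁻¹) (by positivity)).comp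
      tendsto_natCast_atTop_atTop
    refine this.congr fun N => ?_
    simp only [Function.comp_apply]
    rw [inv_mul_eq_div, Nat.floor_div_eq_div]
  have hmain := (hmul.comp (Nat.tendsto_div_const_atTop hn.ne')).mul hquot
  have hrest : Tendsto (fun N : ℕ =>
      (∑ j ∈ Finset.range (N % n), f (n * (N / n) + j)) / N) atTop (𝓝 0) := by
    refine squeeze_zero_norm (fun N => ?_) (tendsto_const_div_atTop_nhds_zero_nat (n * C))
    rw [norm_div, Real.norm_natCast]
    gcongr
    refine (norm_sum_le_of_le _ fun j _ => hf _).trans ?_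
    have hC : 0 ≤ C := (abs_nonneg _).trans (hf 0)
    have hmod : ((N % n : ℕ) : ℝ) ≤ n := by exact_mod_cast (Nat.mod_lt N hn).le
    simpa using mul_le_mul_of_nonneg_right hmod hC
  have hadd := hmain.add hrest
  rw [add_zero, mul_right_comm, mul_inv_cancel₀ hn', one_mul] at hadd
  refine hadd.congr' ?_
  filter_upwards [eventually_ge_atTop n] with N hN
  have hM : ((N / n : ℕ) : ℝ) ≠ 0 := by exact_mod_cast (Nat.div_pos hN hn).ne'
  simp only [Function.comp_apply]
  rw [div_mul_div_cancel₀ hM, ← add_div, ← Finset.sum_range_add, Nat.div_add_mod]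

lemma ae_tendsto_blockIndicator {b n : ℕ} (hb : 0 < b) (hn : 0 < n) (w : Fin n → Fin b) :
    ∀ᵐ x ∂unitMeasure, Tendsto
      (fun N : ℕ => (∑ k ∈ Finset.range N, blockIndicator w k x) / N)
      atTop (𝓝 (1 / (b : ℝ) ^ n)) := by
  have h (r : ℕ) : ∀ᵐ x ∂unitMeasure, Tendsto
      (fun M : ℕ => (∑ j ∈ Finset.range M, blockIndicator w (r + n * j) x) / M)
      atTop (𝓝 (1 / (b : ℝ) ^ n)) := by
    rw [← integral_blockIndicator hb w (r + n * 0)]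
    refine strong_law_ae_real (fun j => blockIndicator w (r + n * j))
      (integrable_blockIndicator w _) (fun i j hij => ?_) fun j =>
        (identDistrib_blockIndicator hb w _).trans (identDistrib_blockIndicator hb w _).symm
    have hlt {i j : ℕ} (hij : i < j) :
        IndepFun (blockIndicator w (r + n * i)) (blockIndicator w (r + n * j))
          unitMeasure := by
      refine indepFun_blockIndicator hb w ?_
      have := Nat.mul_le_mul_left n (Nat.succ_le_of_lt hij)
      rw [Nat.mul_succ] at this
      omega
    rcases lt_or_gt_of_ne hij with h | h
    · exact hlt h
    · exact (hlt h).symm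
  filter_upwards [ae_all_iff.2 h] with x hx
  refine tendsto_average_of_residues (C := 1) hn (fun k => ?_) fun r _ => hx r
  unfold blockIndicator
  split_ifs <;> simp

lemma ae_unitMeasure_isNormal {b : ℕ} (hb : 0 < b) : ∀ᵐ x ∂unitMeasure, IsNormal b x := by
  simp only [IsNormal, ae_all_iff]
  intro n hn w
  filter_upwards [ae_tendsto_blockIndicator hb hn w] with x hx
  simpa only [blockIndicator, Finset.sum_boole] using hx

lemma ae_of_ae_unitMeasure_fract {P : ℝ → Prop} (h : ∀ᵐ x ∂unitMeasure, P x) :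
    ∀ᵐ x : ℝ, P (Int.fract x) := by
  rw [unitMeasure, ae_restrict_iff' measurableSet_Ico] at h
  have hshift : ∀ᵐ x : ℝ, ∀ m : ℤ, x - m ∈ Ico (0 : ℝ) 1 → P (x - m) :=
    ae_all_iff.2 fun m =>
      (measurePreserving_sub_right volume (m : ℝ)).quasiMeasurePreserving.ae h
  filter_upwards [hshift] with x hx
  exact hx ⌊x⌋ ⟨Int.fract_nonneg x, Int.fract_lt_one x⟩

theorem ae_normal {b : ℕ} (hb : 2 ≤ b) :
    ∀ᵐ x : ℝ ∂MeasureTheory.volume, IsNormal b x := by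
  filter_upwards [ae_of_ae_unitMeasure_fract
    (ae_unitMeasure_isNormal (Nat.zero_lt_two.trans_le hb))] with x hx
  intro n hn w
  have h := hx n hn w
  simp only [digit_fract] at h
  exact h
end
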